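/- arXiv:2301.09367 — 2 statements merged into one kernel-verified Lean document; each statement's English description precedes it below -/
import Mathlib

section
/- Let H be a finite group, φ satisfy property (*), and λ be a type with |λ| = k = λ_0 + ⋯ + λ_{e-1}. Suppose that for infinitely many primes p, every subset of Z_p ⋊_φ H \ {id} of type λ is sequenceable. Then every subset of Z_m ⋊_φ H \ {id} of type λ is sequenceable, provided every prime factor of m is greater than k!. -/
open scoped Classical

/-- The `i`-th partial sum (partial product) of a list in a group: `s_i = x_1 ⋯ x_i`, `s_0 = 1`. -/
noncomputable def PartialSum {G : Type*} [Group G] (l : List G) (i : ℕ) : G := (l.take i).prod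

/-- A finite set `S` of non-identity elements of a group is sequenceable if its elements admit
an ordering whose partial sums `s_0, …, s_k` are pairwise distinct, except possibly `s_0 = s_k`. -/
def Sequenceable {G : Type*} [Group G] (S : Finset G) : Prop :=
  ∃ l : List G, l.Nodup ∧ l.toFinset = S ∧
    ∀ i j : ℕ, i < j → j ≤ l.length → ¬(i = 0 ∧ j = l.length) →
      PartialSum l i ≠ PartialSum l j

/-- The homomorphism `H →* MulAut (Multiplicative A)` induced by a sign character
`ε : H →* ℤˣ`: each `h` acts on the abelian group `A` as `±identity` (property (*)). -/
def signAut (A : Type*) [AddCommGroup A] {H : Type*} [Group H] (ε : H →* ℤˣ) :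
    H →* MulAut (Multiplicative A) :=
  MonoidHom.mk'
    (fun h => AddEquiv.toMultiplicative ((DistribMulAction.toAddAut ℤˣ A) (ε h)))
    (by intro a b; simp only [map_mul]; rfl)

/-- If an integer vector `b` lies in the rational span of a set of integer vectors with entries in
`{-1, 0, 1}`, then a nonzero multiple `d • b` with `|d| ≤ n!` lies in their integral span. -/
theorem exists_smul_mem_span_int {ι : Type*} [Fintype ι] (A : Set (ι → ℤ))
    (hA : ∀ a ∈ A, ∀ i, |a i| ≤ 1) (b : ι → ℤ)
    (hb : (fun i => (b i : ℚ)) ∈ Submodule.span ℚ ((fun (a : ι → ℤ) i => (a i : ℚ)) '' A)) :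
    ∃ d : ℤ, d ≠ 0 ∧ |d| ≤ (Fintype.card ι).factorial ∧ d • b ∈ Submodule.span ℤ A := by
  set c : (ι → ℤ) → (ι → ℚ) := fun a i => (a i : ℚ) with hc
  obtain ⟨s, hsA, -, hAs, hs⟩ :=
    exists_linearIndepOn_extension (v := c) (linearIndepOn_empty ℚ c) (Set.empty_subset A)
  obtain ⟨u, hut, hsu, htu, hu⟩ := exists_linearIndepOn_extension hs
    (hsA.trans (Set.subset_union_left (t := Set.range fun i : ι => (Pi.single i 1 : ι → ℤ))))
  have hspan : ⊤ ≤ Submodule.span ℚ (Set.range fun a : u => c a) := by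
    rw [← (Pi.basisFun ℚ ι).span_eq, Submodule.span_le]
    rintro _ ⟨i, rfl⟩
    have h := htu ⟨Pi.single i 1, Or.inr ⟨i, rfl⟩, rfl⟩
    rw [Set.image_eq_range] at h
    convert! h using 1
    ext j
    simp [hc, Pi.single_apply]
  let B₀ := Module.Basis.mk hu hspan
  let e := B₀.indexEquiv (Pi.basisFun ℚ ι)
  let B := B₀.reindex e
  let M : Matrix ι ι ℤ := fun i => (e.symm i : u).1
  have hB : ∀ i, B i = c (M i) := fun i => by
    simp only [B, B₀, M, Module.Basis.reindex_apply]
    exact Module.Basis.mk_apply hu hspan _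
  have hM : M.det ≠ 0 := by
    have h := B.linearIndependent
    have h2 : (⇑B : ι → ι → ℚ) = (M.map (Int.castRingHom ℚ)).row := by
      ext i j
      simp [hB, hc, Matrix.row]
    rw [h2, Matrix.linearIndependent_rows_iff_isUnit, Matrix.isUnit_iff_isUnit_det,
      isUnit_iff_ne_zero, ← RingHom.mapMatrix_apply, ← RingHom.map_det] at h
    intro h0
    simp [h0] at h
  have hent : ∀ i j, AbsoluteValue.abs (M i j) ≤ 1 := fun i j => by
    rcases hut (e.symm i).2 with h | ⟨l, hl⟩
    · exact hA _ h j
    · have : M i = Pi.single l 1 := hl.symm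
      rw [this, Pi.single_apply]
      split_ifs <;> simp
  refine ⟨M.det, hM, by simpa using Matrix.det_le hent, ?_⟩
  let w := Matrix.vecMul b M.adjugate
  have hw : M.det • b = ∑ i, w i • M i := by
    rw [← Matrix.vecMul_eq_sum, Matrix.vecMul_vecMul, Matrix.adjugate_mul, Matrix.vecMul_smul,
      Matrix.vecMul_one]
  have hrepr : (M.det : ℚ) • c b = ∑ i, (w i : ℚ) • B i := by
    ext j
    have := congrArg (fun z : ℤ => (z : ℚ)) (congrFun hw j)
    simpa [hB, hc, Finset.sum_apply] using this
  have hbs : (M.det : ℚ) • c b ∈ Submodule.span ℚ (B '' {i | M i ∈ s}) := by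
    refine Submodule.smul_mem _ _ ?_
    have h1 : Submodule.span ℚ (c '' A) ≤ Submodule.span ℚ (c '' s) := Submodule.span_le.2 hAs
    refine Submodule.span_mono ?_ (h1 hb)
    rintro _ ⟨a, ha, rfl⟩
    have hea : M (e ⟨a, hsu ha⟩) = a := by simp [M]
    exact ⟨e ⟨a, hsu ha⟩, by simpa [hea] using ha, by rw [hB, hea]⟩
  have hsupp := B.mem_span_image.1 hbs
  rw [hw]
  refine Submodule.sum_mem _ fun i _ => ?_
  by_cases hi : M i ∈ s
  · exact Submodule.smul_mem _ _ (Submodule.subset_span (hsA hi))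
  · have h0 : w i = 0 := by
      by_contra hne
      refine hi (hsupp (a := i) ?_)
      rw [hrepr, Finset.mem_coe, Finsupp.mem_support_iff, B.repr_sum_self]
      exact_mod_cast hne
    simp [h0]

/-- Finitely many integer vectors outside the rational span of `A` are simultaneously
non-orthogonal to some integer vector orthogonal to `A`. -/
theorem exists_int_dotProduct_eq_zero_ne_zero {ι κ : Type*} [Fintype ι] [Finite κ]
    (A : Set (ι → ℤ)) (b : κ → ι → ℤ)
    (hb : ∀ l, (fun i => (b l i : ℚ)) ∉
      Submodule.span ℚ ((fun (a : ι → ℤ) i => (a i : ℚ)) '' A)) :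
    ∃ y : ι → ℤ, (∀ a ∈ A, a ⬝ᵥ y = 0) ∧ ∀ l, b l ⬝ᵥ y ≠ 0 := by
  set c : (ι → ℤ) → (ι → ℚ) := fun a i => (a i : ℚ) with hc
  obtain ⟨f, hfA, hfb⟩ := Module.Dual.exists_forall_mem_ne_zero_of_forall_exists
    (Submodule.span ℚ (c '' A)).dualAnnihilator
    (fun l => Module.Dual.eval ℚ (ι → ℚ) (c (b l))) fun l => by
      obtain ⟨f, hf, hfA⟩ := Submodule.exists_le_ker_of_notMem (hb l)
      exact ⟨f, (Submodule.mem_dualAnnihilator f).2 fun w hw => hfA hw, hf⟩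
  obtain ⟨⟨n, hn⟩, hy⟩ := IsLocalization.exist_integer_multiples_of_finite (nonZeroDivisors ℤ)
    fun i : ι => f (Pi.single i 1)
  choose y hy using hy
  have key : ∀ a : ι → ℤ, ((a ⬝ᵥ y : ℤ) : ℚ) = n * f (c a) := fun a => by
    rw [LinearMap.pi_apply_eq_sum_univ f (c a), Finset.mul_sum, dotProduct, Int.cast_sum]
    refine Finset.sum_congr rfl fun i _ => ?_
    have h : (y i : ℚ) = n * f (Pi.single i 1) := by simpa using hy i
    have h2 : (fun j => if i = j then (1 : ℚ) else 0) = Pi.single i 1 := by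
      ext j
      simp [Pi.single_apply, eq_comm]
    rw [h2, Int.cast_mul, h, smul_eq_mul]
    ring
  refine ⟨y, fun a ha => ?_, fun l h => ?_⟩
  · have h := key a
    rw [(Submodule.mem_dualAnnihilator f).1 hfA _ (Submodule.subset_span ⟨a, ha, rfl⟩),
      mul_zero] at h
    exact_mod_cast h
  · have h2 := key (b l)
    rw [h, Int.cast_zero, eq_comm, mul_eq_zero] at h2
    exact h2.elim (by exact_mod_cast nonZeroDivisors.ne_zero hn) (hfb l)

/-- A homogeneous system of equations with coefficients in `{-1, 0, 1}`, together with finitely many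
integral inequations, is solvable over the integers if it is solvable modulo `m`,
provided that every prime factor of `m` exceeds `n!`, where `n` is the number of unknowns. -/
theorem exists_int_solution_of_zmod_solution {ι κ : Type*} [Fintype ι] [Finite κ] {m : ℕ}
    (hm : ∀ q : ℕ, q.Prime → q ∣ m → (Fintype.card ι).factorial < q)
    (A : Set (ι → ℤ)) (hA : ∀ a ∈ A, ∀ i, |a i| ≤ 1) (b : κ → ι → ℤ) (x : ι → ZMod m)
    (hAx : ∀ a ∈ A, ∑ i, (a i : ZMod m) * x i = 0)
    (hbx : ∀ l, ∑ i, (b l i : ZMod m) * x i ≠ 0) :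
    ∃ y : ι → ℤ, (∀ a ∈ A, a ⬝ᵥ y = 0) ∧ ∀ l, b l ⬝ᵥ y ≠ 0 := by
  refine exists_int_dotProduct_eq_zero_ne_zero A b fun l hl => hbx l ?_
  obtain ⟨d, hd0, hd, hspan⟩ := exists_smul_mem_span_int A hA (b l) hl
  let ev : (ι → ℤ) →ₗ[ℤ] ZMod m := ∑ i, (LinearMap.toSpanSingleton ℤ (ZMod m) (x i)).comp
    (LinearMap.proj i)
  have hev : ∀ a, ev a = ∑ i, (a i : ZMod m) * x i := fun a => by simp [ev, LinearMap.sum_apply]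
  have h0 : ev (d • b l) = 0 :=
    (Submodule.span_le (p := LinearMap.ker ev)).2 (fun a ha => (hev a).trans (hAx a ha)) hspan
  rw [map_smul, hev, zsmul_eq_mul] at h0
  have hcop : IsCoprime d m := by
    rw [Int.isCoprime_iff_gcd_eq_one]
    by_contra hne
    obtain ⟨q, hq, hqd⟩ := Nat.exists_prime_and_dvd hne
    have h1 : q ∣ d.natAbs := hqd.trans (Nat.gcd_dvd_left d.natAbs (m : ℤ).natAbs)
    have h2 : q ∣ m := hqd.trans (Nat.gcd_dvd_right d.natAbs (m : ℤ).natAbs)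
    have h3 := Nat.le_of_dvd (Int.natAbs_pos.2 hd0) h1
    have h4 := hm q hq h2
    rw [Int.abs_eq_natAbs] at hd
    omega
  have hunit : IsUnit (d : ZMod m) := by
    obtain ⟨r, t, hrt⟩ := hcop
    have h := congrArg (fun z : ℤ => (z : ZMod m)) hrt
    push_cast at h
    rw [ZMod.natCast_self, mul_zero, add_zero] at h
    exact IsUnit.of_mul_eq_one_right _ h
  exact hunit.mul_right_eq_zero.1 h0

/-- The coefficient vector of the `Z_m`-component of the product of a word in the elements
`(x i, h i)`. -/
noncomputable def wordCoeff {ι H : Type*} [Group H] (ε : H →* ℤˣ) (h : ι → H) : List ι → ι → ℤ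
  | [] => 0
  | i :: L => Pi.single i 1 + ((ε (h i) : ℤˣ) : ℤ) • wordCoeff ε h L

theorem wordCoeff_of_notMem {ι H : Type*} [Group H] (ε : H →* ℤˣ) (h : ι → H) {L : List ι} {i : ι}
    (hi : i ∉ L) : wordCoeff ε h L i = 0 := by
  induction L with
  | nil => rfl
  | cons j L ih =>
    rw [List.mem_cons, not_or] at hi
    simp [wordCoeff, ih hi.2, hi.1]

theorem abs_wordCoeff_le {ι H : Type*} [Group H] (ε : H →* ℤˣ) (h : ι → H) {L : List ι}
    (hL : L.Nodup) (i : ι) : |wordCoeff ε h L i| ≤ 1 := by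
  induction L with
  | nil => simp [wordCoeff]
  | cons j L ih =>
    rw [List.nodup_cons] at hL
    by_cases hij : i = j
    · subst hij
      simp [wordCoeff, wordCoeff_of_notMem ε h hL.1]
    · have hu : |((ε (h j) : ℤˣ) : ℤ)| = 1 := by
        rcases Int.units_eq_one_or (ε (h j)) with h | h <;> simp [h]
      simpa [wordCoeff, hij, abs_mul, hu] using ih hL.2

/-- The product of a word in the elements `(x i, h i)` of `Z_n ⋊ H`. -/
theorem prod_map_mk_eq {ι H : Type*} [Fintype ι] [Group H] (ε : H →* ℤˣ) (h : ι → H) {n : ℕ}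
    (x : ι → ZMod n) (L : List ι) :
    (L.map fun i => (⟨Multiplicative.ofAdd (x i), h i⟩ :
      Multiplicative (ZMod n) ⋊[signAut (ZMod n) ε] H)).prod =
    ⟨Multiplicative.ofAdd (∑ i, (wordCoeff ε h L i : ZMod n) * x i), (L.map h).prod⟩ := by
  induction L with
  | nil => ext <;> simp [wordCoeff]
  | cons j L ih =>
    rw [List.map_cons, List.prod_cons, ih]
    refine SemidirectProduct.ext ?_ (by simp)
    rw [SemidirectProduct.mul_left]
    have hact : ∀ a : ZMod n, signAut (ZMod n) ε (h j) (Multiplicative.ofAdd a) =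
        Multiplicative.ofAdd (((ε (h j) : ℤˣ) : ℤ) • a) := fun a => rfl
    rw [hact, ← ofAdd_add]
    congr 1
    simp [wordCoeff, add_mul, Finset.sum_add_distrib, Finset.mul_sum, Pi.single_apply, mul_assoc]

theorem partialSum_eq_iff_prod_eq_one {G : Type*} [Group G] (l : List G) {i j : ℕ} (hij : i ≤ j) :
    PartialSum l i = PartialSum l j ↔ ((l.take j).drop i).prod = 1 := by
  have h : PartialSum l j = PartialSum l i * ((l.take j).drop i).prod := by
    rw [PartialSum, PartialSum, ← List.prod_append]
    conv_lhs => rw [← List.take_append_drop i (l.take j), List.take_take, min_eq_left hij]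
  rw [h, eq_comm, mul_eq_left]

/-- A parametrized set is sequenceable iff some ordering of the parameters has no proper
block with trivial product. -/
theorem sequenceable_map_univ_iff {ι G : Type*} [Fintype ι] [Group G] (f : ι ↪ G) :
    Sequenceable (Finset.univ.map f) ↔ ∃ L : List ι, L.Nodup ∧ (∀ i, i ∈ L) ∧
      ∀ i j : ℕ, i < j → j ≤ L.length → ¬(i = 0 ∧ j = L.length) →
        (((L.take j).drop i).map f).prod ≠ 1 := by
  constructor
  · rintro ⟨l, hl, hlS, hseq⟩
    have hrange : l ∈ Set.range (List.map f) := by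
      rw [Set.range_list_map]
      intro g hg
      simpa using (hlS ▸ List.mem_toFinset.2 hg : g ∈ Finset.univ.map f)
    obtain ⟨L, rfl⟩ := hrange
    refine ⟨L, List.Nodup.of_map f hl, fun i => ?_, fun i j hij hj hne => ?_⟩
    · have : f i ∈ (L.map f).toFinset := hlS ▸ Finset.mem_map_of_mem f (Finset.mem_univ i)
      simpa using this
    · have := hseq i j hij (by simpa using hj) (by simpa using hne)
      rwa [Ne, partialSum_eq_iff_prod_eq_one _ hij.le, ← List.map_take, ← List.map_drop] at this
  · rintro ⟨L, hL, hmem, hseq⟩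
    refine ⟨L.map f, hL.map f.injective, ?_, fun i j hij hj hne => ?_⟩
    · ext g
      simp [hmem]
    · rw [Ne, partialSum_eq_iff_prod_eq_one _ hij.le, ← List.map_take, ← List.map_drop]
      exact hseq i j hij (by simpa using hj) (by simpa using hne)

/-- if, for infinitely many primes `p`, every subset of `Z_p ⋊_φ H` of type `λ` is
sequenceable, then every subset of `Z_m ⋊_φ H` of type `λ` is sequenceable, provided every
prime factor of `m` exceeds `k!` where `k = λ_0 + ⋯ + λ_{e-1}`. -/
theorem stmt6 (H : Type*) [Group H] [Fintype H] (ε : H →* ℤˣ) (lam : H → ℕ)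
    (hp : {p : ℕ | p.Prime ∧
      ∀ S : Finset (Multiplicative (ZMod p) ⋊[signAut (ZMod p) ε] H),
        (1 : Multiplicative (ZMod p) ⋊[signAut (ZMod p) ε] H) ∉ S →
        (∀ a : H, (S.filter fun g => g.right = a).card = lam a) →
        Sequenceable S}.Infinite)
    (m : ℕ)
    (hm : ∀ q : ℕ, q.Prime → q ∣ m → (Finset.univ.sum lam).factorial < q)
    (S : Finset (Multiplicative (ZMod m) ⋊[signAut (ZMod m) ε] H))
    (h1 : (1 : Multiplicative (ZMod m) ⋊[signAut (ZMod m) ε] H) ∉ S)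
    (hT : ∀ a : H, (S.filter fun g => g.right = a).card = lam a) :
    Sequenceable S := by
  have hcard : Fintype.card S = Finset.univ.sum lam := by
    rw [Fintype.card_coe, Finset.card_eq_sum_card_fiberwise (f := fun g => g.right)
      (t := Finset.univ) fun _ _ => Finset.mem_coe.2 (Finset.mem_univ _)]
    exact Finset.sum_congr rfl fun a _ => hT a
  let h : S → H := fun g => g.1.right
  let x : S → ZMod m := fun g => Multiplicative.toAdd g.1.left
  let f (n : ℕ) (y : S → ZMod n) (i : S) : Multiplicative (ZMod n) ⋊[signAut (ZMod n) ε] H :=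
    ⟨Multiplicative.ofAdd (y i), h i⟩
  have hfx : f m x = Subtype.val := rfl
  let A : Set (S → ℤ) := {a | ∃ L : List S, L.Nodup ∧ a = wordCoeff ε h L ∧
    ∑ i, (a i : ZMod m) * x i = 0}
  let κ := {v : S × S // v.1 ≠ v.2 ∧ h v.1 = h v.2} ⊕ {i : S // h i = 1}
  let b : κ → S → ℤ := Sum.elim (fun v => Pi.single v.1.1 1 - Pi.single v.1.2 1)
    fun i => Pi.single i.1 1
  obtain ⟨y, hyA, hyb⟩ := exists_int_solution_of_zmod_solution (hcard ▸ hm) A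
    (by rintro _ ⟨L, hL, rfl, -⟩; exact abs_wordCoeff_le ε h hL) b x
    (by rintro a ⟨L, -, -, ha⟩; exact ha) (by
      rintro (⟨⟨i, j⟩, hij, hh⟩ | ⟨i, hi⟩) h0
      · simp [b, Pi.single_apply, sub_mul, Finset.sum_sub_distrib, sub_eq_zero] at h0
        exact hij (Subtype.ext (SemidirectProduct.ext h0 hh))
      · simp [b, Pi.single_apply] at h0
        exact h1 ((SemidirectProduct.ext h0 hi : i.1 = 1) ▸ i.2))
  obtain ⟨N, hN⟩ := (Set.finite_range fun l => (b l ⬝ᵥ y).natAbs).bddAbove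
  obtain ⟨p, ⟨hpp, hpS⟩, hNp⟩ := hp.exists_gt N
  let z : S → ZMod p := fun i => (y i : ZMod p)
  have hz : ∀ a : S → ℤ, ∑ i, (a i : ZMod p) * z i = ((a ⬝ᵥ y : ℤ) : ZMod p) := fun a => by
    simp [dotProduct, z]
  have hzb : ∀ l, ∑ i, (b l i : ZMod p) * z i ≠ 0 := fun l h0 => by
    rw [hz, ZMod.intCast_zmod_eq_zero_iff_dvd, Int.natCast_dvd] at h0
    have h2 := Nat.le_of_dvd (Int.natAbs_pos.2 (hyb l)) h0
    exact absurd (hN ⟨l, rfl⟩) (not_le.2 (hNp.trans_le h2))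
  have hinj : Function.Injective (f p z) := fun i j hij => by
    by_contra hne
    have hh : h i = h j := (SemidirectProduct.ext_iff.1 hij).2
    have hl : z i = z j := (SemidirectProduct.ext_iff.1 hij).1
    apply hzb (Sum.inl ⟨(i, j), hne, hh⟩)
    simp [b, Pi.single_apply, sub_mul, Finset.sum_sub_distrib, hl]
  have hinjm : Function.Injective (f m x) := hfx ▸ Subtype.val_injective
  have hmap : Finset.univ.map ⟨f m x, hinjm⟩ = S := by
    ext g
    simp [hfx]
  have hone : (1 : Multiplicative (ZMod p) ⋊[signAut (ZMod p) ε] H) ∉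
      Finset.univ.map ⟨f p z, hinj⟩ := fun hmem => by
    obtain ⟨i, -, hi⟩ := Finset.mem_map.1 hmem
    have hh : h i = 1 := (SemidirectProduct.ext_iff.1 hi).2
    have hl : z i = 0 := (SemidirectProduct.ext_iff.1 hi).1
    apply hzb (Sum.inr ⟨i, hh⟩)
    simp [b, Pi.single_apply, hl]
  have hcount : ∀ (n : ℕ) (w : S → ZMod n) (hw : Function.Injective (f n w)) (a : H),
      ((Finset.univ.map ⟨f n w, hw⟩).filter fun g => g.right = a).card =
        (Finset.univ.filter fun i => h i = a).card := fun n w hw a => by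
    rw [Finset.filter_map, Finset.card_map]
    rfl
  obtain ⟨L, hL, hmem, hseq⟩ := (sequenceable_map_univ_iff _).1
    (hpS (Finset.univ.map ⟨f p z, hinj⟩) hone fun a => by
      rw [hcount p z hinj, ← hcount m x hinjm, hmap, hT])
  rw [← hmap]
  refine (sequenceable_map_univ_iff _).2
    ⟨L, hL, hmem, fun i j hij hj hne h0 => hseq i j hij hj hne ?_⟩
  have h0' := (prod_map_mk_eq ε h x _).symm.trans h0
  refine (prod_map_mk_eq ε h z _).trans
    (SemidirectProduct.ext ?_ (SemidirectProduct.ext_iff.1 h0').2)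
  have hmemA : wordCoeff ε h ((L.take j).drop i) ∈ A :=
    ⟨_, hL.sublist ((List.drop_sublist _ _).trans (List.take_sublist _ _)), rfl,
      (SemidirectProduct.ext_iff.1 h0').1⟩
  have h2 : ∑ t, (wordCoeff ε h ((L.take j).drop i) t : ZMod p) * z t = 0 := by
    rw [hz, hyA _ hmemA, Int.cast_zero]
  exact h2
end

section
/- Let m be a positive integer all of whose prime factors exceed k!, where k ≤ 12. Then every subset S of D_{2m} \ {id} with |S| = k is sequenceable; moreover, if S contains at least one reflection (i.e., S is not of type (k,0)), then S admits a linear sequencing, i.e., an ordering with all partial sums s_0, …, s_k pairwise distinct (including s_0 ≠ s_k). -/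
open scoped Classical

/-- A finite set `S` of non-identity elements of a group has a linear sequencing if its elements
admit an ordering whose partial sums `s_0, …, s_k` are pairwise distinct (including `s_0 ≠ s_k`). -/
def LinearSequenceable {G : Type*} [Group G] (S : Finset G) : Prop :=
  ∃ l : List G, l.Nodup ∧ l.toFinset = S ∧
    ∀ i j : ℕ, i < j → j ≤ l.length → PartialSum l i ≠ PartialSum l j

/-! ### Sequencings and products of contiguous sublists -/

theorem partialSum_eq_mul {G : Type*} [Group G] (l : List G) {i j : ℕ} (hij : i ≤ j) :
    PartialSum l j = PartialSum l i * ((l.drop i).take (j - i)).prod := by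
  obtain ⟨d, rfl⟩ := Nat.exists_eq_add_of_le hij
  simp [PartialSum, List.take_add]

/-- Two partial sums differ if the contiguous sublists of the length between them have nontrivial
product. -/
theorem partialSum_ne_of_infix {G : Type*} [Group G] {l : List G} {i j : ℕ} (hij : i < j)
    (hj : j ≤ l.length)
    (h : ∀ v, v <:+: l → v ≠ [] → v.length = j - i → v.prod ≠ 1) :
    PartialSum l i ≠ PartialSum l j := by
  rw [partialSum_eq_mul l hij.le]
  intro he
  have hlen : ((l.drop i).take (j - i)).length = j - i := by simp; omega
  refine h _ ((List.take_prefix _ _).isInfix.trans (List.drop_suffix _ _).isInfix) ?_ hlen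
    (by simpa using he.symm)
  intro h0
  rw [h0] at hlen
  simp at hlen
  omega

theorem linearSequenceable_of_infix {G : Type*} [Group G] {S : Finset G} {l : List G}
    (hl : l.Nodup) (hS : ∀ x, x ∈ l ↔ x ∈ S) (h : ∀ v, v <:+: l → v ≠ [] → v.prod ≠ 1) :
    LinearSequenceable S :=
  ⟨l, hl, by ext x; simp [hS], fun _ _ hij hj =>
    partialSum_ne_of_infix hij hj fun v hv h0 _ => h v hv h0⟩

theorem sequenceable_of_infix {G : Type*} [Group G] {S : Finset G} {l : List G}
    (hl : l.Nodup) (hS : ∀ x, x ∈ l ↔ x ∈ S)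
    (h : ∀ v, v <:+: l → v ≠ [] → v ≠ l → v.prod ≠ 1) : Sequenceable S :=
  ⟨l, hl, by ext x; simp [hS], fun i j hij hj hne =>
    partialSum_ne_of_infix hij hj fun v hv h0 hlen => h v hv h0 (by rintro rfl; omega)⟩

/-! ### Sets of nonzero integers -/

theorem sum_neg_of_forall_neg {v : List ℤ} (hv : ∀ y ∈ v, y < 0) (h0 : v ≠ []) : v.sum < 0 := by
  induction v with
  | nil => exact absurd rfl h0
  | cons a v ih =>
    rcases eq_or_ne v [] with rfl | hne
    · simpa using hv
    · have := ih (fun y hy => hv y (by simp [hy])) hne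
      have := hv a (by simp)
      simp only [List.sum_cons]
      omega

theorem exists_neg_of_sum_nonpos {u : List ℤ} (h0 : u ≠ []) (hu : ∀ x ∈ u, x ≠ 0)
    (hs : u.sum ≤ 0) : ∃ x ∈ u, x < 0 := by
  by_contra! h
  have := sum_neg_of_forall_neg (v := u.map (fun x => -x))
    (by simp only [List.mem_map]
        rintro _ ⟨x, hx, rfl⟩
        have := h x hx
        have := hu x hx
        omega) (by simpa using h0)
  have h2 : (u.map (fun x => -x)).sum = -u.sum := by
    rw [List.sum_neg]
  omega

/-- In a list whose positive entries precede the negative ones, a proper nonempty prefix has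
positive sum as soon as the whole sum is nonnegative. -/
theorem prefix_sum_pos {u v : List ℤ} (hpn : (u ++ v).Pairwise (fun x y => x < 0 → y < 0))
    (hnz : ∀ x ∈ u ++ v, x ≠ 0) (h0 : u ≠ [])
    (hs : 0 < (u ++ v).sum ∨ (0 = (u ++ v).sum ∧ v ≠ [])) : 0 < u.sum := by
  by_contra! hu
  obtain ⟨x, hx, hx0⟩ := exists_neg_of_sum_nonpos h0 (fun x hx => hnz x (by simp [hx])) hu
  have hv : ∀ y ∈ v, y < 0 := fun y hy => (List.pairwise_append.1 hpn).2.2 x hx y hy hx0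
  rw [List.sum_append] at hs
  rcases eq_or_ne v [] with rfl | hne
  · simp at hs
    omega
  · have := sum_neg_of_forall_neg hv hne
    omega

/-- An ordering of `A` with the positive entries first. -/
structure PosNegOrdering (A : Finset ℤ) (l : List ℤ) : Prop where
  nodup : l.Nodup
  mem : ∀ x, x ∈ l ↔ x ∈ A
  posNeg : l.Pairwise (fun x y => x < 0 → y < 0)

theorem PosNegOrdering.sum_eq {A : Finset ℤ} {l : List ℤ} (h : PosNegOrdering A l) :
    l.sum = ∑ x ∈ A, x := by
  have : l.toFinset = A := by ext x; simp [h.mem]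
  rw [← this, List.sum_toFinset _ h.nodup]
  simp

theorem PosNegOrdering.cons {A : Finset ℤ} {l : List ℤ} {p : ℤ} (hp : p ∈ A) (hp0 : 0 < p)
    (h : PosNegOrdering (A.erase p) l) : PosNegOrdering A (p :: l) where
  nodup := List.nodup_cons.2 ⟨by simp [h.mem], h.nodup⟩
  mem x := by
    by_cases hx : x = p
    · simp [hx, hp]
    · simp [h.mem, hx]
  posNeg := List.pairwise_cons.2 ⟨fun y _ hp' => absurd hp' (by omega), h.posNeg⟩

theorem PosNegOrdering.neg_reverse {A : Finset ℤ} {l : List ℤ} (h0 : (0 : ℤ) ∉ A)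
    (h : PosNegOrdering A l) :
    PosNegOrdering (A.map (Equiv.neg ℤ).toEmbedding) (l.map (fun x => -x)).reverse where
  nodup := List.nodup_reverse.2 (h.nodup.map neg_injective)
  mem x := by
    simp only [List.mem_reverse, List.mem_map, Finset.mem_map, h.mem]
    rfl
  posNeg := by
    rw [List.pairwise_reverse, List.pairwise_map]
    refine h.posNeg.imp_of_mem ?_
    intro a b ha hb hab hb'
    have : a ≠ 0 := by rintro rfl; exact h0 ((h.mem 0).1 ha)
    omega

/-- A finite set of nonzero integers with nonzero sum can be ordered with no zero-sum
contiguous sublist. -/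
theorem exists_posNegOrdering_of_sum_ne_zero (n : ℕ) : ∀ A : Finset ℤ, A.card = n →
    (0 : ℤ) ∉ A → ∑ x ∈ A, x ≠ 0 →
    ∃ l, PosNegOrdering A l ∧ ∀ v, v <:+: l → v ≠ [] → v.sum ≠ 0 := by
  induction n with
  | zero =>
    intro A hA _ hs
    rw [Finset.card_eq_zero] at hA
    simp [hA] at hs
  | succ n ih =>
    have key : ∀ A : Finset ℤ, A.card = n + 1 → (0 : ℤ) ∉ A → 0 < ∑ x ∈ A, x →
        ∃ l, PosNegOrdering A l ∧ ∀ v, v <:+: l → v ≠ [] → v.sum ≠ 0 := by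
      intro A hA h0 hs
      obtain ⟨p, hp, hp0⟩ : ∃ p ∈ A, 0 < p := by
        by_contra! h
        exact absurd (Finset.sum_nonpos h) (by omega)
      obtain ⟨p, hp, hp0, hl⟩ : ∃ p ∈ A, 0 < p ∧
          ∃ l, PosNegOrdering (A.erase p) l ∧ ∀ v, v <:+: l → v ≠ [] → v.sum ≠ 0 := by
        by_cases hq : ∃ q ∈ A, 0 < q ∧ ∑ x ∈ A.erase q, x ≠ 0
        · obtain ⟨q, hq, hq0, hqs⟩ := hq
          exact ⟨q, hq, hq0, ih _ (by rw [Finset.card_erase_of_mem hq, hA]; rfl)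
            (by simp [h0]) hqs⟩
        · push Not at hq
          have hsum : ∀ q ∈ A, 0 < q → q = ∑ x ∈ A, x := fun q hqA hq0 => by
            rw [← Finset.add_sum_erase A (fun x => x) hqA, hq q hqA hq0, add_zero]
          have herase : A.erase p = ∅ := by
            by_contra hne
            have hneg : ∀ x ∈ A.erase p, x < 0 := by
              intro x hx
              rw [Finset.mem_erase] at hx
              by_contra! hx0
              have hx1 : x ≠ 0 := by rintro rfl; exact h0 hx.2
              exact hx.1 ((hsum x hx.2 (by omega)).trans (hsum p hp hp0).symm)
            have := Finset.sum_lt_sum_of_nonempty (Finset.nonempty_iff_ne_empty.2 hne) hneg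
            rw [hq p hp hp0] at this
            simp at this
          refine ⟨p, hp, hp0, [], ⟨by simp, by simp [herase], by simp⟩, ?_⟩
          intro v hv hv0
          exact absurd (List.infix_nil.1 hv) hv0
      obtain ⟨l, hl, hz⟩ := hl
      have hl' := hl.cons hp hp0
      refine ⟨p :: l, hl', fun v hv hv0 => ?_⟩
      rcases List.infix_cons_iff.1 hv with ⟨w, hw⟩ | hv
      · refine (prefix_sum_pos (v := w) (hw ▸ hl'.posNeg) ?_ hv0 (Or.inl ?_)).ne'
        · rw [hw]
          rintro x hx rfl
          exact h0 ((hl'.mem 0).1 hx)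
        · rw [hw, hl'.sum_eq]
          exact hs
      · exact hz v hv hv0
    intro A hA h0 hs
    rcases lt_or_gt_of_ne hs with hlt | hgt
    · set A' := A.map (Equiv.neg ℤ).toEmbedding with hA'
      have h0' : (0 : ℤ) ∉ A' := by simpa [hA'] using h0
      obtain ⟨l, hl, hz⟩ := key A' (by simp [hA', hA]) h0'
        (by rw [hA', Finset.sum_map]; simpa [Finset.sum_neg_distrib (f := fun x : ℤ => x)] using hlt)
      have hAA : A'.map (Equiv.neg ℤ).toEmbedding = A := by ext; simp [hA']
      refine ⟨_, hAA ▸ hl.neg_reverse h0', ?_⟩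
      intro v hv hv0 hvs
      refine hz (v.map (fun x => -x)).reverse ?_ (by simpa using hv0) ?_
      · have := List.reverse_infix.2 (hv.map (fun x => -x))
        simpa [List.map_reverse, Function.comp_def] using this
      · rw [List.sum_reverse]
        have h2 : (v.map (fun x => -x)).sum = -v.sum := by
          rw [List.sum_neg]
        rw [h2, hvs, neg_zero]
    · exact key A hA h0 hgt

/-- A finite set of nonzero integers can be ordered with no zero-sum proper contiguous sublist. -/
theorem exists_ordering_int (A : Finset ℤ) (h0 : (0 : ℤ) ∉ A) :
    ∃ l : List ℤ, l.Nodup ∧ (∀ x, x ∈ l ↔ x ∈ A) ∧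
      ∀ v, v <:+: l → v ≠ [] → v ≠ l → v.sum ≠ 0 := by
  by_cases hs : ∑ x ∈ A, x = 0
  · rcases A.eq_empty_or_nonempty with rfl | hne
    · exact ⟨[], by simp, by simp, fun v hv hv0 => absurd (List.infix_nil.1 hv) hv0⟩
    obtain ⟨p, hp, hp0⟩ : ∃ p ∈ A, 0 < p := by
      by_contra! h
      have := Finset.sum_lt_sum_of_nonempty (f := fun x => x) (g := fun _ => (0 : ℤ)) hne
        fun x hx => lt_of_le_of_ne (h x hx) (by rintro rfl; exact h0 hx)
      simp [hs] at this
    have hes := Finset.add_sum_erase A (fun x => x) hp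
    obtain ⟨l, hl, hz⟩ := exists_posNegOrdering_of_sum_ne_zero _ (A.erase p) rfl (by simp [h0])
      (by omega)
    have hl' := hl.cons hp hp0
    refine ⟨p :: l, hl'.nodup, hl'.mem, fun v hv hv0 hvl => ?_⟩
    rcases List.infix_cons_iff.1 hv with ⟨w, hw⟩ | hv
    · refine (prefix_sum_pos (v := w) (hw ▸ hl'.posNeg) ?_ hv0 (Or.inr ⟨?_, ?_⟩)).ne'
      · rw [hw]
        rintro x hx rfl
        exact h0 ((hl'.mem 0).1 hx)
      · rw [hw, hl'.sum_eq, hs]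
      · rintro rfl
        exact hvl (by simpa using hw)
    · exact hz v hv hv0
  · obtain ⟨l, hl, hz⟩ := exists_posNegOrdering_of_sum_ne_zero _ A rfl h0 hs
    exact ⟨l, hl.nodup, hl.mem, fun v hv hv0 _ => hz v hv hv0⟩

/-! ### The infinite dihedral group -/

namespace DihedralGroup

/-- The rotation or reflection with integer parameter in the infinite dihedral group. -/
def ofInt : Bool → ℤ → DihedralGroup 0
  | false, x => r x
  | true, x => sr x

theorem ofInt_injective2 {e e' : Bool} {x y : ℤ} (h : ofInt e x = ofInt e' y) :
    e = e' ∧ x = y := by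
  cases e <;> cases e'
  · exact ⟨rfl, r.inj h⟩
  · cases h
  · cases h
  · exact ⟨rfl, sr.inj h⟩

theorem exists_ofInt (g : DihedralGroup 0) : ∃ e x, g = ofInt e x := by
  rcases g with x | x
  · exact ⟨false, x, rfl⟩
  · exact ⟨true, x, rfl⟩

/-- `Climbs t e l` says that the walk of partial products along `l`, started in the coset of
rotations (`e = false`) or of reflections (`e = true`), increases the potential
`2 p` at `r p` and `2 t - 1 - 2 q` at `sr q` in each step. -/
def Climbs (t : ℤ) : Bool → List (Bool × ℤ) → Prop
  | _, [] => True
  | false, (false, x) :: l => 0 < x ∧ Climbs t false l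
  | true, (false, x) :: l => x < 0 ∧ Climbs t true l
  | false, (true, b) :: l => b < t ∧ Climbs t true l
  | true, (true, b) :: l => t ≤ b ∧ Climbs t false l

theorem Climbs.drop {t : ℤ} : ∀ {e : Bool} {u v : List (Bool × ℤ)}, Climbs t e (u ++ v) →
    ∃ e', Climbs t e' v
  | e, [], _, h => ⟨e, h⟩
  | false, (false, _) :: _, _, h => Climbs.drop h.2
  | true, (false, _) :: _, _, h => Climbs.drop h.2
  | false, (true, _) :: _, _, h => Climbs.drop h.2
  | true, (true, _) :: _, _, h => Climbs.drop h.2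

theorem Climbs.take {t : ℤ} : ∀ {e : Bool} {u v : List (Bool × ℤ)}, Climbs t e (u ++ v) →
    Climbs t e u
  | _, [], _, _ => by simp [Climbs]
  | false, (false, _) :: _, _, h => ⟨h.1, Climbs.take h.2⟩
  | true, (false, _) :: _, _, h => ⟨h.1, Climbs.take h.2⟩
  | false, (true, _) :: _, _, h => ⟨h.1, Climbs.take h.2⟩
  | true, (true, _) :: _, _, h => ⟨h.1, Climbs.take h.2⟩

/-- The potential of a walk that is in the coset of `ofInt e p`. -/
def potential (t : ℤ) : Bool → ℤ → ℤ
  | false, p => 2 * p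
  | true, q => 2 * t - 1 - 2 * q

theorem ofInt_mul_r (x y : ℤ) : ofInt false x * ofInt false y = ofInt false (x + y) := rfl
theorem ofInt_r_mul_sr (x y : ℤ) : ofInt false x * ofInt true y = ofInt true (y - x) := rfl
theorem ofInt_sr_mul_r (x y : ℤ) : ofInt true x * ofInt false y = ofInt true (x + y) := rfl
theorem ofInt_sr_mul_sr (x y : ℤ) : ofInt true x * ofInt true y = ofInt false (y - x) := rfl

theorem Climbs.potential_le {t : ℤ} : ∀ {l : List (Bool × ℤ)} {e : Bool} (p : ℤ),
    Climbs t e l → ∃ e' p', ofInt e p * (l.map fun a => ofInt a.1 a.2).prod = ofInt e' p' ∧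
      potential t e p + l.length ≤ potential t e' p'
  | [], e, p, _ => ⟨e, p, by simp⟩
  | (false, x) :: l, false, p, h => by
    obtain ⟨e', p', he, hp⟩ := Climbs.potential_le (p + x) h.2
    refine ⟨e', p', by simp [← he, ← mul_assoc, ofInt_mul_r], ?_⟩
    have := h.1
    simp [potential] at hp ⊢
    omega
  | (false, x) :: l, true, p, h => by
    obtain ⟨e', p', he, hp⟩ := Climbs.potential_le (p + x) h.2
    refine ⟨e', p', by simp [← he, ← mul_assoc, ofInt_sr_mul_r], ?_⟩
    have := h.1
    simp [potential] at hp ⊢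
    omega
  | (true, x) :: l, false, p, h => by
    obtain ⟨e', p', he, hp⟩ := Climbs.potential_le (x - p) h.2
    refine ⟨e', p', by simp [← he, ← mul_assoc, ofInt_r_mul_sr], ?_⟩
    have := h.1
    simp [potential] at hp ⊢
    omega
  | (true, x) :: l, true, p, h => by
    obtain ⟨e', p', he, hp⟩ := Climbs.potential_le (x - p) h.2
    refine ⟨e', p', by simp [← he, ← mul_assoc, ofInt_sr_mul_sr], ?_⟩
    have := h.1
    simp [potential] at hp ⊢
    omega

theorem Climbs.prod_ne_one {t : ℤ} {e : Bool} {l : List (Bool × ℤ)} (h : Climbs t e l)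
    (h0 : l ≠ []) : (l.map fun a => ofInt a.1 a.2).prod ≠ 1 := by
  intro h1
  obtain ⟨e', p', he, hp⟩ := h.potential_le 0
  rw [h1, mul_one] at he
  obtain ⟨rfl, rfl⟩ := ofInt_injective2 he
  have := List.length_pos_of_ne_nil h0
  omega

theorem Climbs.append_pos {t : ℤ} {l : List (Bool × ℤ)} (hl : Climbs t false l) :
    ∀ {u : List ℤ}, (∀ x ∈ u, 0 < x) → Climbs t false (u.map (Prod.mk false) ++ l)
  | [], _ => hl
  | a :: u, hu => ⟨hu a (by simp), hl.append_pos fun x hx => hu x (by simp [hx])⟩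

theorem Climbs.append_neg {t : ℤ} {l : List (Bool × ℤ)} (hl : Climbs t true l) :
    ∀ {u : List ℤ}, (∀ x ∈ u, x < 0) → Climbs t true (u.map (Prod.mk false) ++ l)
  | [], _ => hl
  | a :: u, hu => ⟨hu a (by simp), hl.append_neg fun x hx => hu x (by simp [hx])⟩

theorem exists_climbs_interleave {t : ℤ} : ∀ as bs : List ℤ, (∀ a ∈ as, a < t) →
    (∀ b ∈ bs, t ≤ b) → (bs.length = as.length ∨ bs.length = as.length + 1) →
    ∃ l : List ℤ, l.Perm (as ++ bs) ∧ Climbs t true (l.map (Prod.mk true))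
  | [], [], _, _, _ => ⟨[], by simp, trivial⟩
  | [], [b], _, hb, _ => ⟨[b], by simp, hb b (by simp), trivial⟩
  | [], _ :: _ :: _, _, _, h => by simp at h
  | _ :: _, [], _, _, h => by simp at h
  | a :: as, b :: bs, ha, hb, h => by
    obtain ⟨l, hl, hc⟩ := exists_climbs_interleave (t := t) as bs
      (fun x hx => ha x (by simp [hx])) (fun x hx => hb x (by simp [hx])) (by simpa using h)
    exact ⟨b :: a :: l, ((hl.cons a).cons b).trans (List.perm_middle (l₁ := a :: as)).symm,
      hb b (by simp), ha a (by simp), hc⟩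

theorem exists_climbs_reflections (B : Finset ℤ) (hB : B.Nonempty) :
    ∃ (t b : ℤ) (l : List ℤ), (b :: l).Nodup ∧ (∀ x, x ∈ b :: l ↔ x ∈ B) ∧ b < t ∧
      Climbs t true (l.map (Prod.mk true)) := by
  set s := B.sort (· ≤ ·) with hs
  have hlen : 0 < s.length := by simpa [hs] using hB
  obtain ⟨c, hc⟩ : ∃ c, c = s[(s.length - 1) / 2]'(by omega) := ⟨_, rfl⟩
  set u := s.take ((s.length - 1) / 2) with hu
  set v := s.drop ((s.length - 1) / 2 + 1) with hv
  have hsplit : s = u ++ c :: v := by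
    rw [hc, hu, hv, List.getElem_cons_drop, List.take_append_drop]
  have hsorted : s.Pairwise (· < ·) := B.sortedLT_sort.pairwise
  rw [hsplit] at hsorted
  have h1 := List.pairwise_append.1 hsorted
  obtain ⟨l, hl, hcl⟩ := exists_climbs_interleave (t := c + 1) u v
    (fun a ha => (h1.2.2 a ha c (by simp)).trans (by omega))
    (fun b hb => (List.pairwise_cons.1 h1.2.1).1 b hb)
    (by simp [hu, hv]; omega)
  have hperm : (c :: l).Perm s := by
    rw [hsplit]
    exact (hl.cons c).trans List.perm_middle.symm
  exact ⟨c + 1, c, l, hperm.nodup_iff.2 (B.sort_nodup _),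
    fun x => by rw [hperm.mem_iff, hs, Finset.mem_sort], by omega, hcl⟩

/-- A finite set of elements of the infinite dihedral group containing a reflection can be ordered
so that no nonempty contiguous sublist has trivial product. -/
theorem exists_ordering_of_sr_mem (S : Finset (DihedralGroup 0)) (h1 : 1 ∉ S) {i : ℤ}
    (hi : ofInt true i ∈ S) :
    ∃ l : List (DihedralGroup 0), l.Nodup ∧ (∀ x, x ∈ l ↔ x ∈ S) ∧
      ∀ v, v <:+: l → v ≠ [] → v.prod ≠ 1 := by
  have hfin : ∀ e, (ofInt e ⁻¹' (S : Set (DihedralGroup 0))).Finite := fun e =>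
    S.finite_toSet.preimage fun x _ y _ h => (ofInt_injective2 h).2
  set R := (hfin false).toFinset with hR
  have hRmem : ∀ x, x ∈ R ↔ ofInt false x ∈ S := by simp [hR]
  obtain ⟨t, b, l, hnd, hmem, hbt, hl⟩ := exists_climbs_reflections (hfin true).toFinset
    ⟨i, by simpa using hi⟩
  set P := (R.filter (0 < ·)).toList with hP
  set N := (R.filter (· < 0)).toList with hN
  have hPmem : ∀ x, x ∈ P ↔ ofInt false x ∈ S ∧ 0 < x := by simp [hP, hRmem]
  have hNmem : ∀ x, x ∈ N ↔ ofInt false x ∈ S ∧ x < 0 := by simp [hN, hRmem]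
  have hBmem : ∀ x, (x = b ∨ x ∈ l) ↔ ofInt true x ∈ S := by simpa using hmem
  set L : List (Bool × ℤ) := P.map (Prod.mk false) ++
    (true, b) :: (N.map (Prod.mk false) ++ l.map (Prod.mk true)) with hL
  have hneg : Climbs t true (N.map (Prod.mk false) ++ l.map (Prod.mk true)) :=
    hl.append_neg fun x hx => ((hNmem x).1 hx).2
  have hmid : Climbs t false
      ((true, b) :: (N.map (Prod.mk false) ++ l.map (Prod.mk true))) := ⟨hbt, hneg⟩
  have hclimb : Climbs t false L := hmid.append_pos fun x hx => ((hPmem x).1 hx).2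
  have hLmem : ∀ a : Bool × ℤ, a ∈ L ↔ ofInt a.1 a.2 ∈ S := by
    have h0 : ofInt false 0 ∉ S := h1
    rintro ⟨_ | _, x⟩
    · simp only [hL, List.mem_append, List.mem_cons, List.mem_map, Prod.mk.injEq, true_and,
        exists_eq_right, hPmem, hNmem, reduceCtorEq, false_and, and_false, exists_false, or_false,
        false_or]
      constructor
      · rintro (h | h) <;> exact h.1
      · intro h
        have : x ≠ 0 := by rintro rfl; exact h0 h
        rcases lt_or_gt_of_ne this with h' | h'
        · exact Or.inr ⟨h, h'⟩
        · exact Or.inl ⟨h, h'⟩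
    · simpa [hL] using hBmem x
  have hLnd : L.Nodup := by
    have hinj : ∀ e : Bool, Function.Injective (Prod.mk e : ℤ → Bool × ℤ) :=
      fun e x y h => (Prod.mk.inj h).2
    rw [hL, List.perm_middle.nodup_iff, List.nodup_cons, ← List.append_assoc, List.nodup_append,
      List.nodup_append]
    rw [List.nodup_cons] at hnd
    refine ⟨by simpa using hnd.1, ⟨(Finset.nodup_toList _).map (hinj _),
      (Finset.nodup_toList _).map (hinj _), ?_⟩, hnd.2.map (hinj _), ?_⟩
    · simp only [List.mem_map]
      rintro _ ⟨x, hx, rfl⟩ _ ⟨y, hy, rfl⟩ h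
      have h2 := ((hPmem x).1 hx).2
      have h3 := ((hNmem y).1 hy).2
      have := (Prod.mk.inj h).2
      omega
    · simp only [List.mem_append, List.mem_map]
      rintro _ (⟨x, hx, rfl⟩ | ⟨x, hx, rfl⟩) _ ⟨y, hy, rfl⟩ h <;> simp at h
  refine ⟨L.map fun a => ofInt a.1 a.2, hLnd.map ?_, ?_, ?_⟩
  · rintro ⟨e, x⟩ ⟨e', y⟩ h
    obtain ⟨rfl, rfl⟩ := ofInt_injective2 h
    rfl
  · intro g
    obtain ⟨e, x, rfl⟩ := exists_ofInt g
    rw [← hLmem (e, x), List.mem_map]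
    constructor
    · rintro ⟨⟨e', y⟩, ha, h⟩
      obtain ⟨rfl, rfl⟩ := ofInt_injective2 h
      exact ha
    · exact fun h => ⟨_, h, rfl⟩
  · rintro v ⟨u, w, huw⟩ hv0
    obtain ⟨L₁, L₂, hL12, h12, -⟩ := List.map_eq_append_iff.1 huw.symm
    obtain ⟨L₃, L₄, rfl, -, rfl⟩ := List.map_eq_append_iff.1 h12
    rw [hL12] at hclimb
    obtain ⟨e, he⟩ := hclimb.take.drop
    exact he.prod_ne_one (by rintro rfl; simp at hv0)

/-- A finite set of rotations other than `1` of the infinite dihedral group can be ordered so that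
no nonempty proper contiguous sublist has trivial product. -/
theorem exists_ordering_of_rotations (S : Finset (DihedralGroup 0)) (h1 : 1 ∉ S)
    (hS : ∀ i, ofInt true i ∉ S) :
    ∃ l : List (DihedralGroup 0), l.Nodup ∧ (∀ x, x ∈ l ↔ x ∈ S) ∧
      ∀ v, v <:+: l → v ≠ [] → v ≠ l → v.prod ≠ 1 := by
  have hfin : (ofInt false ⁻¹' (S : Set (DihedralGroup 0))).Finite :=
    S.finite_toSet.preimage fun x _ y _ h => (ofInt_injective2 h).2
  have hprod : ∀ l : List ℤ, (l.map (ofInt false)).prod = ofInt false l.sum := by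
    intro l
    induction l with
    | nil => rfl
    | cons a l ih => simp [ih, ofInt_mul_r]
  obtain ⟨l, hnd, hmem, hz⟩ := exists_ordering_int hfin.toFinset
    (by simpa using (show ofInt false 0 ∉ S from h1))
  refine ⟨l.map (ofInt false), hnd.map fun x y h => (ofInt_injective2 h).2, ?_, ?_⟩
  · intro g
    obtain ⟨_ | _, x, rfl⟩ := exists_ofInt g
    · rw [List.mem_map_of_injective fun x y h => (ofInt_injective2 h).2, hmem]
      simp
    · simp only [List.mem_map, hS, iff_false]
      rintro ⟨y, -, hy⟩
      exact absurd (ofInt_injective2 hy).1 (by simp)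
  · rintro v ⟨u, w, huw⟩ hv0 hvl
    obtain ⟨L₁, L₂, hL12, h12, -⟩ := List.map_eq_append_iff.1 huw.symm
    obtain ⟨L₃, L₄, rfl, -, rfl⟩ := List.map_eq_append_iff.1 h12
    rw [hprod]
    intro h
    refine hz L₄ ⟨L₃, L₂, hL12.symm⟩ (by rintro rfl; simp at hv0) (by rintro rfl; simp at hvl)
      (ofInt_injective2 (e := false) (e' := false) (y := 0) h).2

end DihedralGroup

/-! ### Rectification -/

theorem isUnit_intCast_zmod {m K : ℕ} (hm : ∀ q : ℕ, q.Prime → q ∣ m → K < q) {d : ℤ}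
    (hd : d ≠ 0) (hdK : |d| ≤ K) : IsUnit (d : ZMod m) := by
  rw [ZMod.coe_int_isUnit_iff_isCoprime, Int.isCoprime_iff_nat_coprime, Int.natAbs_natCast]
  refine Nat.coprime_of_dvd fun q hq hqm hqd => ?_
  have h1 := hm q hq hqm
  have h2 := Nat.le_of_dvd (Int.natAbs_pos.2 hd) hqd
  rw [Int.abs_eq_natAbs] at hdK
  omega

/-- Vectors over `ZMod m`, where `m` has only large prime factors, have integer models satisfying
every relation with coefficients in `{-1, 0, 1}`. -/
theorem exists_int_model {ι : Type*} [Fintype ι] {m : ℕ} (hm : 0 < m)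
    (hfac : ∀ q : ℕ, q.Prime → q ∣ m → (Fintype.card ι).factorial < q) (x : ι → ZMod m) :
    ∃ (y : ι → ℤ) (d : ZMod m), IsUnit d ∧ (∀ i, (y i : ZMod m) = d * x i) ∧
      ∀ c : ι → ℤ, (∀ i, |c i| ≤ 1) → ∑ i, (c i : ZMod m) * x i = 0 → ∑ i, c i * y i = 0 := by
  have : NeZero m := ⟨hm.ne'⟩
  let T : Set (ι → ℚ) := {v | ∃ c : ι → ℤ, (∀ i, |c i| ≤ 1) ∧ v = fun i => (c i : ℚ)}
  let C : Set (ι → ℚ) := {v | ∃ c : ι → ℤ, (∀ i, |c i| ≤ 1) ∧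
    ∑ i, (c i : ZMod m) * x i = 0 ∧ v = fun i => (c i : ℚ)}
  obtain ⟨B₀, hB₀C, -, hCB₀, hB₀⟩ := exists_linearIndepOn_id_extension
    (linearIndepOn_empty ℚ id) (Set.empty_subset C)
  obtain ⟨B, hBT, hB₀B, hTB, hB⟩ := exists_linearIndepOn_id_extension hB₀
    (hB₀C.trans (fun v ⟨c, hc, _, hv⟩ => ⟨c, hc, hv⟩ : C ⊆ T))
  have hspan : ⊤ ≤ Submodule.span ℚ (Set.range ((↑) : B → ι → ℚ)) := by
    rw [Subtype.range_coe, ← (Pi.basisFun ℚ ι).span_eq, Submodule.span_le]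
    rintro _ ⟨i, rfl⟩
    refine hTB ⟨Pi.single i 1, fun j => ?_, ?_⟩
    · by_cases h : j = i <;> simp [h]
    · ext j
      by_cases h : j = i <;> simp [h]
  let bas : Module.Basis B ℚ (ι → ℚ) := Module.Basis.mk hB hspan
  let e : ι ≃ B := (Pi.basisFun ℚ ι).indexEquiv bas
  choose c hc1 hc2 using fun i => hBT (e i).2
  let A : Matrix ι ι ℤ := Matrix.of c
  have hA0 : A.det ≠ 0 := by
    have hli : LinearIndependent ℚ (A.map (Int.castRingHom ℚ)).row := by
      have h2 : (A.map (Int.castRingHom ℚ)).row = fun i => ((e i : B) : ι → ℚ) := by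
        funext i
        exact (hc2 i).symm
      rw [h2]
      exact LinearIndependent.comp hB e e.injective
    have h3 := (Matrix.isUnit_iff_isUnit_det _).1 (Matrix.linearIndependent_rows_iff_isUnit.1 hli)
    intro h0
    rw [← RingHom.mapMatrix_apply, ← RingHom.map_det, h0] at h3
    simp at h3
  have hAle : |A.det| ≤ ((Fintype.card ι).factorial : ℕ) := by
    have := Matrix.det_le (A := A) (abv := AbsoluteValue.abs) (x := 1) (fun i j => hc1 i j)
    simpa using this
  let w : ι → ℤ := fun i => ((∑ j, (A i j : ZMod m) * x j).val : ℤ)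
  let y : ι → ℤ := A.adjugate.mulVec w
  have hAy : A.mulVec y = A.det • w := by
    simp [y, Matrix.mulVec_mulVec, Matrix.mul_adjugate]
  refine ⟨y, (A.det : ZMod m), isUnit_intCast_zmod hfac hA0 hAle, fun i => ?_, fun a ha hax => ?_⟩
  · let f := Int.castRingHom (ZMod m)
    have hw : (fun i => f (w i)) = (A.map f).mulVec x := by
      funext i
      simp [w, f, Matrix.mulVec, dotProduct]
    have hy : (fun i => f (y i)) = (A.adjugate.map f).mulVec fun i => f (w i) := by
      funext i
      simp only [y]
      rw [RingHom.map_mulVec]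
      rfl
    have h4 : A.adjugate.map f * A.map f = f A.det • (1 : Matrix ι ι (ZMod m)) := by
      rw [← Matrix.map_mul, Matrix.adjugate_mul]
      ext i j
      simp only [Matrix.map_apply, Matrix.smul_apply, Matrix.one_apply, smul_eq_mul, map_mul]
      split_ifs <;> simp
    rw [hw, Matrix.mulVec_mulVec, h4, Matrix.smul_mulVec, Matrix.one_mulVec] at hy
    exact congrFun hy i
  · have hmem : (fun i => (a i : ℚ)) ∈ Submodule.span ℚ B₀ := hCB₀ ⟨a, ha, hax, rfl⟩
    let φ : (ι → ℚ) →ₗ[ℚ] ℚ := ∑ i, (y i : ℚ) • LinearMap.proj i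
    have hφ : ∀ v, φ v = ∑ i, (y i : ℚ) * v i := by simp [φ]
    have hker : Submodule.span ℚ B₀ ≤ LinearMap.ker φ := by
      rw [Submodule.span_le]
      intro v hv
      obtain ⟨i, hi⟩ := e.surjective ⟨v, hB₀B hv⟩
      have hvi : v = fun j => (c i j : ℚ) := by rw [← hc2 i, hi]
      obtain ⟨c', -, hc'x, hc'v⟩ := hB₀C hv
      have hcc : c' = c i := by
        funext j
        exact_mod_cast congrFun (hc'v.symm.trans hvi) j
      have hwi : w i = 0 := by
        simp only [w, A, Matrix.of_apply, ← hcc, hc'x]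
        simp
      have h5 := congrFun hAy i
      simp only [Pi.smul_apply, hwi, smul_zero, Matrix.mulVec, dotProduct, A,
        Matrix.of_apply] at h5
      rw [SetLike.mem_coe, LinearMap.mem_ker, hφ, hvi]
      have h6 : ((∑ j, c i j * y j : ℤ) : ℚ) = 0 := by rw [h5]; simp
      push_cast at h6
      simpa [mul_comm] using h6
    have h7 := LinearMap.mem_ker.1 (hker hmem)
    rw [hφ] at h7
    have h8 : ((∑ i, a i * y i : ℤ) : ℚ) = 0 := by
      push_cast
      simpa [mul_comm] using h7
    exact_mod_cast h8

namespace DihedralGroup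

/-- The rotation or reflection with a given parameter. -/
def ofZMod {n : ℕ} : Bool → ZMod n → DihedralGroup n
  | false, x => r x
  | true, x => sr x

/-- Whether an element is a reflection. -/
def isRefl {n : ℕ} : DihedralGroup n → Bool
  | r _ => false
  | sr _ => true

/-- The parameter of a rotation or reflection. -/
def param {n : ℕ} : DihedralGroup n → ZMod n
  | r x => x
  | sr x => x

theorem ofZMod_isRefl_param {n : ℕ} (g : DihedralGroup n) : ofZMod (isRefl g) (param g) = g := by
  cases g <;> rfl

theorem ofZMod_injective2 {n : ℕ} {e e' : Bool} {x y : ZMod n} (h : ofZMod e x = ofZMod e' y) :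
    e = e' ∧ x = y := by
  cases e <;> cases e' <;> simp_all [ofZMod]

theorem ofZMod_mul {n : ℕ} (e e' : Bool) (x y : ZMod n) :
    ofZMod e x * ofZMod e' y =
      ofZMod (xor e e') (((if e' then -1 else 1 : ℤ) : ZMod n) * x + y) := by
  cases e <;> cases e' <;> simp [ofZMod] <;> ring

/-- The parameter of a product of distinct elements is a combination of their parameters with
coefficients in `{-1, 0, 1}` which depend only on their types and order. -/
theorem exists_coeff_prod {α : Type*} [DecidableEq α] (ε : α → Bool) : ∀ l : List α, l.Nodup →
    ∃ (c : α → ℤ) (e : Bool), (∀ a, |c a| ≤ 1) ∧ (∀ a, a ∉ l → c a = 0) ∧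
      ∀ (n : ℕ) (z : α → ZMod n), (l.map fun a => ofZMod (ε a) (z a)).prod =
        ofZMod e (∑ a ∈ l.toFinset, (c a : ZMod n) * z a)
  | [], _ => ⟨fun _ => 0, false, by simp, by simp, fun _ _ => rfl⟩
  | b :: l, hl => by
    rw [List.nodup_cons] at hl
    obtain ⟨c, e, hc1, hc0, hc⟩ := exists_coeff_prod ε l hl.2
    refine ⟨Function.update c b (if e then -1 else 1), xor (ε b) e, fun a => ?_, fun a ha => ?_,
      fun n z => ?_⟩
    · by_cases h : a = b
      · subst h
        cases e <;> simp
      · simpa [h] using hc1 a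
    · rw [List.mem_cons, not_or] at ha
      simpa [ha.1] using hc0 a ha.2
    · rw [List.map_cons, List.prod_cons, hc, ofZMod_mul, List.toFinset_cons,
        Finset.sum_insert (by simpa using hl.1), Function.update_self]
      congr 2
      refine Finset.sum_congr rfl fun a ha => ?_
      rw [Function.update_of_ne]
      rintro rfl
      exact hl.1 (by simpa using ha)

/-- A set of `k` elements of the dihedral group of order `2 m`, where all prime factors of `m`
exceed `k!`, has a model in the infinite dihedral group in which every product of distinct elements
trivial in the original set is trivial. -/
theorem exists_model {m : ℕ} (hm : 0 < m) (S : Finset (DihedralGroup m))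
    (hfac : ∀ q : ℕ, q.Prime → q ∣ m → S.card.factorial < q) :
    ∃ φ : DihedralGroup m → DihedralGroup 0, Set.InjOn φ S ∧ (∀ g ∈ S, φ g = 1 → g = 1) ∧
      (∀ g, isRefl (φ g) = isRefl g) ∧
      ∀ l : List (DihedralGroup m), l.Nodup → (∀ g ∈ l, g ∈ S) → l.prod = 1 →
        (l.map φ).prod = 1 := by
  obtain ⟨y, d, hd, hyd, hy⟩ := exists_int_model (ι := S) hm (by simpa using hfac)
    fun g => param g.1
  let z : DihedralGroup m → ZMod 0 := fun g => if h : g ∈ S then y ⟨g, h⟩ else (0 : ℤ)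
  have hz : ∀ g (h : g ∈ S), z g = y ⟨g, h⟩ := fun g h => dif_pos h
  have hrefl : ∀ {n : ℕ} (e : Bool) (x : ZMod n), isRefl (ofZMod e x) = e := by
    rintro n (_ | _) x <;> rfl
  refine ⟨fun g => ofZMod (isRefl g) (z g), fun g hg h hh hgh => ?_, fun g hg h1 => ?_,
    fun g => hrefl _ _, fun l hl hlS hl1 => ?_⟩
  · obtain ⟨he, hx⟩ := ofZMod_injective2 hgh
    rw [hz g hg, hz h hh] at hx
    have h2 : d * param g = d * param h := by
      rw [← hyd ⟨g, hg⟩, ← hyd ⟨h, hh⟩, hx]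
    rw [← ofZMod_isRefl_param g, ← ofZMod_isRefl_param h, he, hd.mul_left_cancel h2]
  · obtain ⟨he, hx⟩ := ofZMod_injective2 (e' := false) (y := 0) h1
    rw [hz g hg] at hx
    have h2 : d * param g = d * 0 := by
      rw [← hyd ⟨g, hg⟩, hx, mul_zero]
      exact Int.cast_zero
    rw [← ofZMod_isRefl_param g, he, hd.mul_left_cancel h2]
    rfl
  · obtain ⟨c, e, hc1, hc0, hc⟩ := exists_coeff_prod isRefl l hl
    have hsub : l.toFinset ⊆ S := fun g hg => hlS g (by simpa using hg)
    have hsum : ∀ (n : ℕ) (z : DihedralGroup m → ZMod n),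
        ∑ g ∈ l.toFinset, (c g : ZMod n) * z g = ∑ g : S, (c g.1 : ZMod n) * z g.1 := by
      intro n z
      rw [Finset.sum_subset hsub fun g _ hg => by simp [hc0 g (by simpa using hg)]]
      exact (Finset.sum_coe_sort S fun g => (c g : ZMod n) * z g).symm
    have h1 := hc m param
    simp only [ofZMod_isRefl_param, List.map_id', hl1, hsum] at h1
    obtain ⟨he, hx⟩ := ofZMod_injective2 (e := false) (x := 0) h1
    rw [hc 0 z, hsum, ← he]
    have h0 := hy (fun g => c g.1) (fun g => hc1 g.1) hx.symm
    have h2 : ∑ g : S, (Int.cast (c g.1) : ZMod 0) * z g.1 = 0 := by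
      refine Eq.trans ?_ h0
      refine Finset.sum_congr rfl fun g _ => ?_
      rw [hz g.1 g.2]
      rfl
    rw [h2]
    rfl

end DihedralGroup

/-- An ordering of the image of `S` under a map injective on `S` comes from an ordering of `S`. -/
theorem exists_ordering_pullback {α β : Type*} {S : Finset α} {φ : α → β} (hφ : Set.InjOn φ S)
    {l : List β} (hl : l.Nodup) (hmem : ∀ b, b ∈ l ↔ b ∈ S.image φ) :
    ∃ l' : List α, l'.Nodup ∧ (∀ a, a ∈ l' ↔ a ∈ S) ∧ l'.map φ = l := by
  obtain ⟨l', rfl⟩ : l ∈ Set.range (List.map fun a : S => φ a) := by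
    rw [Set.range_list_map]
    intro b hb
    obtain ⟨a, ha, rfl⟩ := Finset.mem_image.1 ((hmem b).1 hb)
    exact ⟨⟨a, ha⟩, rfl⟩
  refine ⟨l'.map (↑), (hl.of_map _).map Subtype.val_injective, fun a => ?_, by simp⟩
  constructor
  · simp only [List.mem_map]
    rintro ⟨a, -, rfl⟩
    exact a.2
  · intro ha
    obtain ⟨b, hb, hba⟩ := List.mem_map.1 ((hmem _).2 (Finset.mem_image_of_mem φ ha))
    exact List.mem_map.2 ⟨b, hb, hφ b.2 ha hba⟩

/-- if every prime factor of `m` exceeds `k!` and `k ≤ 12`, every `k`-subset of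
non-identity elements of `D_{2m}` is sequenceable; moreover if it contains a reflection it has
a linear sequencing. -/
theorem stmt9 (m k : ℕ) (hm : 0 < m) (hk : k ≤ 12)
    (hfac : ∀ q : ℕ, q.Prime → q ∣ m → k.factorial < q)
    (S : Finset (DihedralGroup m)) (h1 : (1 : DihedralGroup m) ∉ S) (hcard : S.card = k) :
    Sequenceable S ∧
      ((∃ i : ZMod m, DihedralGroup.sr i ∈ S) → LinearSequenceable S) := by
  obtain ⟨φ, hinj, hone, hrefl, hprod⟩ := DihedralGroup.exists_model hm S (by rwa [hcard])
  have h1' : (1 : DihedralGroup 0) ∉ S.image φ := by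
    rw [Finset.mem_image]
    rintro ⟨g, hg, hg1⟩
    exact h1 (hone g hg hg1 ▸ hg)
  have hpull : ∀ {l : List (DihedralGroup m)}, l.Nodup → (∀ g, g ∈ l ↔ g ∈ S) →
      ∀ v, v <:+: l → (v.map φ).prod ≠ 1 → v.prod ≠ 1 := fun hnd hmem v hv hne h =>
    hne (hprod v (hnd.sublist hv.sublist) (fun g hg => (hmem g).1 (hv.subset hg)) h)
  have hlin : (∃ i : ZMod m, DihedralGroup.sr i ∈ S) → LinearSequenceable S := by
    rintro ⟨i, hi⟩
    obtain ⟨j, hj⟩ : ∃ j : ℤ, φ (DihedralGroup.sr i) = DihedralGroup.ofInt true j := by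
      have := hrefl (DihedralGroup.sr i)
      rcases hφ : φ (DihedralGroup.sr i) with j | j
      · rw [hφ] at this
        simp [DihedralGroup.isRefl] at this
      · exact ⟨j, rfl⟩
    obtain ⟨l, hnd, hmem, hl⟩ := DihedralGroup.exists_ordering_of_sr_mem (S.image φ) h1'
      (hj ▸ Finset.mem_image_of_mem φ hi)
    obtain ⟨l', hnd', hmem', rfl⟩ := exists_ordering_pullback hinj hnd (by simpa using hmem)
    exact linearSequenceable_of_infix hnd' hmem' fun v hv hv0 =>
      hpull hnd' hmem' v hv (hl _ (hv.map φ) (by simpa using hv0))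
  refine ⟨?_, hlin⟩
  by_cases hsr : ∃ i : ZMod m, DihedralGroup.sr i ∈ S
  · obtain ⟨l, hnd, hmem, hl⟩ := hlin hsr
    exact ⟨l, hnd, hmem, fun i j hij hj _ => hl i j hij hj⟩
  · have hrot : ∀ i, DihedralGroup.ofInt true i ∉ S.image φ := by
      intro i hi
      obtain ⟨g, hg, hgi⟩ := Finset.mem_image.1 hi
      have := hrefl g
      rw [hgi] at this
      rcases g with j | j
      · simp [DihedralGroup.isRefl, DihedralGroup.ofInt] at this
      · exact hsr ⟨j, hg⟩
    obtain ⟨l, hnd, hmem, hl⟩ := DihedralGroup.exists_ordering_of_rotations (S.image φ) h1' hrot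
    obtain ⟨l', hnd', hmem', rfl⟩ := exists_ordering_pullback hinj hnd (by simpa using hmem)
    refine sequenceable_of_infix hnd' hmem' fun v hv hv0 hvl =>
      hpull hnd' hmem' v hv (hl _ (hv.map φ) (by simpa using hv0) fun h => hvl ?_)
    exact hv.eq_of_length (by simpa using congrArg List.length h)
end
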